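/- Let v_−, x_− ∈ ℝⁿ with v_−·x_− = 0 and |v_−| ≥ μ, let 0 < r < min(|v_−|/2^{3/2}, 1), and let y_− ∈ M_r satisfy A(y_−) = y_−. Then, with a_sc(v_−,x_−) := ∫_{−∞}^∞ F(z_−(v_−,τ)+x_−+y_−(τ)) dτ, one has |a_sc(v_−,x_−) − ∫_{−∞}^∞ F(z_−(v_−,τ)+x_−) dτ| ≤ (4 max(β₂,β^s_3)² n^{3/2}(√n(3|x_−|+2r)+2) / (α²(|v_−|/2^{3/2} − r)²(1−r)^{2α+3})) · (1/(|v_−|/2^{3/2} − r) + 1)². -/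

import Mathlib

open MeasureTheory Real Filter Set Topology RealInnerProductSpace

noncomputable section

namespace Paper

/-- ℝⁿ -/
abbrev Euc (n : ℕ) : Type := EuclideanSpace ℝ (Fin n)

variable {n : ℕ}

/-- the norm `sup_{t ≤ 0} ‖f t‖ + sup_{t ≥ 0} ‖f t‖/(1+t)` on the space `M_r`. -/
def Mnorm (f : ℝ → Euc n) : ℝ :=
  sSup ((fun t => ‖f t‖) '' Iic 0) + sSup ((fun t => ‖f t‖ / (1 + t)) '' Ici 0)

/-- membership in the complete metric space `M_r`. -/
def MemM (r : ℝ) (f : ℝ → Euc n) : Prop :=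
  Continuous f ∧ BddAbove ((fun t => ‖f t‖) '' Iic 0) ∧
    BddAbove ((fun t => ‖f t‖ / (1 + t)) '' Ici 0) ∧ Mnorm f ≤ r

/-- the long range decay conditions on `V^l`. -/
def LongRange (α βl0 βl1 βl2 : ℝ) (Vl : Euc n → ℝ) : Prop :=
  ContDiff ℝ 2 Vl ∧
    (∀ x, |Vl x| ≤ βl0 * (1 + ‖x‖) ^ (-α)) ∧
    (∀ x, ‖gradient Vl x‖ ≤ βl1 * (1 + ‖x‖) ^ (-(α + 1))) ∧
    (∀ x, ‖iteratedFDeriv ℝ 2 Vl x‖ ≤ βl2 * (1 + ‖x‖) ^ (-(α + 2)))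

/-- the short range decay conditions on `V^s`. -/
def ShortRange (α βs1 βs2 βs3 : ℝ) (Vs : Euc n → ℝ) : Prop :=
  ContDiff ℝ 2 Vs ∧
    (∀ x, |Vs x| ≤ βs1 * (1 + ‖x‖) ^ (-(α + 1))) ∧
    (∀ x, ‖gradient Vs x‖ ≤ βs2 * (1 + ‖x‖) ^ (-(α + 2))) ∧
    (∀ x, ‖iteratedFDeriv ℝ 2 Vs x‖ ≤ βs3 * (1 + ‖x‖) ^ (-(α + 3)))

/-- `z` is a C² solution of `z'' = Fl ∘ z` with `z 0 = x0`, `z' → w` along the filter `l`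
(`atBot` for `z_-`, `atTop` for `z_+`), satisfying the growth bound `‖z t - x0 - t w‖ ≤ C |t|`. -/
def IsFreeSol (Fl : Euc n → Euc n) (x0 w : Euc n) (l : Filter ℝ) (C : ℝ)
    (z : ℝ → Euc n) : Prop :=
  ContDiff ℝ 2 z ∧ (∀ t, deriv (deriv z) t = Fl (z t)) ∧ z 0 = x0 ∧
    Tendsto (fun t => deriv z t) l (𝓝 w) ∧ ∀ t, ‖z t - x0 - t • w‖ ≤ C * |t|

/-- the map `A` (or `𝒜` when `xm = 0` and `zm` already contains the base point). -/
def Aop (Fl F : Euc n → Euc n) (zm : ℝ → Euc n) (xm : Euc n)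
    (f : ℝ → Euc n) (t : ℝ) : Euc n :=
  ∫ σ in Iic t, ∫ τ in Iic σ, (F (zm τ + xm + f τ) - Fl (zm τ))

/-- the vector `l(v_-,x_-,y_-)`. -/
def lInt (Fl Fs F : Euc n → Euc n) (zm : ℝ → Euc n) (xm : Euc n) (ym : ℝ → Euc n) : Euc n :=
  (∫ σ in Iic (0:ℝ), ∫ τ in Iic σ, (F (zm τ + xm + ym τ) - Fl (zm τ))) -
    ∫ σ in Ici (0:ℝ), ∫ τ in Ici σ, Fs (zm τ + xm + ym τ)

/-- the vector `l₁(v_-,x_-)`. -/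
def l1Int (Fl : Euc n → Euc n) (zp : ℝ → Euc n) (xm : Euc n) : Euc n :=
  -∫ σ in Ici (0:ℝ), ∫ τ in Ici σ, (Fl (zp τ + xm) - Fl (zp τ))

/-- the vector `l₂(v_-,x_-,y_-)`. -/
def l2Int (Fl : Euc n → Euc n) (zm zp : ℝ → Euc n) (xm : Euc n) (ym : ℝ → Euc n) : Euc n :=
  -∫ σ in Ici (0:ℝ), ∫ τ in Ici σ, (Fl (zm τ + xm + ym τ) - Fl (zp τ + xm))

/-- the function `y_+`. -/
def yplusInt (Fl F : Euc n → Euc n) (zm zp : ℝ → Euc n) (xm : Euc n) (ym : ℝ → Euc n)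
    (t : ℝ) : Euc n :=
  ∫ σ in Ici t, ∫ τ in Ici σ, (F (zm τ + xm + ym τ) - Fl (zp τ))

/-- the vector `W(v_-,x_-)`. -/
def Wvec (Fl : Euc n → Euc n) (zm zp : ℝ → Euc n) (xm : Euc n) : Euc n :=
  (∫ σ in Iic (0:ℝ), ∫ τ in Iic σ, (Fl (zm τ + xm) - Fl (zm τ))) -
    ∫ σ in Ici (0:ℝ), ∫ τ in Ici σ, (Fl (zp τ + xm) - Fl (zp τ))

/-- the map `𝒢_{v_-,x_-}`; here `zm = z_-(v_-,x_-,·)` contains the base point `x_-`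
and `zp h = z_+(ã, x_- + h, ·)`. -/
def Gmap (Fl Fs F : Euc n → Euc n) (zm : ℝ → Euc n) (zp : Euc n → ℝ → Euc n)
    (ym : ℝ → Euc n) (h : Euc n) : Euc n :=
  lInt Fl Fs F zm 0 ym -
    ∫ σ in Ici (0:ℝ), ∫ τ in Ici σ, (Fl (zm τ + ym τ) - Fl (zp h τ))

/-- the vector `W̃(v_-,x_-)`; here `zp0 = z_+(ã, x_-, ·)`. -/
def Wtilde (Fl : Euc n → Euc n) (zm zp0 : ℝ → Euc n) : Euc n :=
  (∫ τ in Iic (0:ℝ), Fl (zm τ)) + ∫ τ in Ici (0:ℝ), Fl (zp0 τ)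

/-- Tail integral of a shifted power on a right half-line. -/
theorem integral_Ioi_affine_rpow {ρ R p s : ℝ} (hρ : 0 < ρ) (hR : 0 < R) (hp : 1 < p)
    (hs : 0 ≤ s) :
    IntegrableOn (fun t => (ρ + R * t) ^ (-p)) (Ioi s) ∧
      ∫ t in Ioi s, (ρ + R * t) ^ (-p) = (ρ + R * s) ^ (-(p - 1)) / (R * (p - 1)) := by
  have hp1 : 0 < p - 1 := by linarith
  have hpos : ∀ t ∈ Ici s, 0 < ρ + R * t := fun t ht => by
    have : 0 ≤ R * t := mul_nonneg hR.le (hs.trans ht)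
    linarith
  have hderiv : ∀ t ∈ Ici s,
      HasDerivAt (fun t => -((ρ + R * t) ^ (-(p - 1)) / (R * (p - 1)))) ((ρ + R * t) ^ (-p)) t := by
    intro t ht
    have h1 : HasDerivAt (fun t : ℝ => ρ + R * t) R t := by
      simpa using ((hasDerivAt_id t).const_mul R).const_add ρ
    have h2 := ((h1.rpow_const (p := -(p - 1)) (Or.inl (hpos t ht).ne')).div_const
      (R * (p - 1))).neg
    rw [show -(p - 1) - 1 = -p by ring] at h2
    refine h2.congr_deriv ?_
    field_simp
  have hlim : Tendsto (fun t => -((ρ + R * t) ^ (-(p - 1)) / (R * (p - 1)))) atTop (𝓝 0) := by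
    have h1 : Tendsto (fun t : ℝ => ρ + R * t) atTop atTop :=
      tendsto_atTop_add_const_left _ _ (tendsto_id.const_mul_atTop hR)
    simpa using (((tendsto_rpow_neg_atTop hp1).comp h1).div_const (R * (p - 1))).neg
  have hnn : ∀ t ∈ Ioi s, 0 ≤ (ρ + R * t) ^ (-p) := fun t ht =>
    (rpow_pos_of_pos (hpos t (Ioi_subset_Ici_self ht)) _).le
  have hint := integrableOn_Ioi_deriv_of_nonneg' hderiv hnn hlim
  refine ⟨hint, ?_⟩
  rw [integral_Ioi_of_hasDerivAt_of_tendsto' hderiv hint hlim]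
  ring

theorem integral_Iic_abs_rpow {ρ R p s : ℝ} (hρ : 0 < ρ) (hR : 0 < R) (hp : 1 < p)
    (hs : s ≤ 0) :
    ∫ t in Iic s, (ρ + R * |t|) ^ (-p) = (ρ + R * |s|) ^ (-(p - 1)) / (R * (p - 1)) := by
  rw [abs_of_nonpos hs, ← (integral_Ioi_affine_rpow hρ hR hp (neg_nonneg.2 hs)).2,
    ← integral_comp_neg_Iic]
  refine setIntegral_congr_fun measurableSet_Iic fun t ht => ?_
  simp only [abs_of_nonpos (le_trans ht hs)]

theorem integral_abs_rpow {ρ R p : ℝ} (hρ : 0 < ρ) (hR : 0 < R) (hp : 1 < p) :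
    ∫ t : ℝ, (ρ + R * |t|) ^ (-p) = 2 * (ρ ^ (-(p - 1)) / (R * (p - 1))) := by
  rw [integral_comp_abs (f := fun t => (ρ + R * t) ^ (-p)),
    (integral_Ioi_affine_rpow hρ hR hp le_rfl).2]
  simp

theorem integrable_abs_rpow {ρ R p : ℝ} (hρ : 0 < ρ) (hR : 0 < R) (hp : 1 < p) :
    Integrable (fun t : ℝ => (ρ + R * |t|) ^ (-p)) := by
  have hp1 : 0 < p - 1 := by linarith
  refine .of_integral_ne_zero (ne_of_gt ?_)
  rw [integral_abs_rpow hρ hR hp]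
  positivity

section Decay

variable {E : Type*} [NormedAddCommGroup E]

/-- Power decay, with one order less on the positive half-line. -/
def DecayBound (ρ R α K L : ℝ) (f : ℝ → E) : Prop :=
  (∀ t ≤ 0, ‖f t‖ ≤ K * (ρ + R * |t|) ^ (-(α + 2))) ∧
    ∀ t, 0 < t → ‖f t‖ ≤ K * (ρ + R * |t|) ^ (-(α + 2)) + L * (ρ + R * |t|) ^ (-(α + 1))

theorem DecayBound.exists_dominating {ρ R α K L : ℝ} {f : ℝ → E} (hf : DecayBound ρ R α K L f)
    (hρ : 0 < ρ) (hR : 0 < R) (hα : 0 < α) :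
    ∃ B : ℝ → ℝ, Integrable B ∧ (∀ t, ‖f t‖ ≤ B t) ∧
      ∫ t, B t = 2 * K * ρ ^ (-(α + 1)) / (R * (α + 1)) + L * ρ ^ (-α) / (R * α) := by
  have h2 := integral_Ioi_affine_rpow (p := α + 1) hρ hR (by linarith) le_rfl
  have hi1 := (integrable_abs_rpow (p := α + 2) hρ hR (by linarith)).const_mul K
  have hi2 : Integrable ((Ioi 0).indicator fun t => L * (ρ + R * t) ^ (-(α + 1))) :=
    (integrable_indicator_iff measurableSet_Ioi).2 (h2.1.const_mul L)
  refine ⟨fun t => K * (ρ + R * |t|) ^ (-(α + 2)) +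
    (Ioi 0).indicator (fun t => L * (ρ + R * t) ^ (-(α + 1))) t, hi1.add hi2, fun t => ?_, ?_⟩
  · rcases le_or_gt t 0 with ht | ht
    · simpa [indicator, not_lt.2 ht] using hf.1 t ht
    · simpa [indicator, ht, abs_of_pos ht] using hf.2 t ht
  · rw [integral_add hi1 hi2, integral_const_mul, integral_indicator measurableSet_Ioi,
      integral_const_mul, h2.2, integral_abs_rpow hρ hR (by linarith),
      show α + 2 - 1 = α + 1 by ring, show α + 1 - 1 = α by ring]
    simp only [mul_zero, add_zero]
    ring

theorem DecayBound.of_growth {ρ R α c A B : ℝ} {f : ℝ → E} (hρ : 0 < ρ) (hR : 0 < R)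
    (hc : 0 ≤ c) (hB : 0 ≤ B)
    (hf : ∀ t, ‖f t‖ ≤ c * (ρ + R * |t|) ^ (-(α + 2)) * (A + B * max t 0)) :
    DecayBound ρ R α (c * A) (c * (B / R)) f := by
  refine ⟨fun t ht => (hf t).trans (le_of_eq ?_), fun t ht => (hf t).trans ?_⟩
  · rw [max_eq_right ht]
    ring
  · have hm : 0 < ρ + R * |t| := by positivity
    rw [max_eq_left ht.le, show -(α + 1) = -(α + 2) + 1 by ring, rpow_add_one hm.ne']
    have h1 : c * (B / R) * ((ρ + R * |t|) ^ (-(α + 2)) * (ρ + R * |t|)) =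
        c * (ρ + R * |t|) ^ (-(α + 2)) * (B * t) +
          c * (B / R) * (ρ + R * |t|) ^ (-(α + 2)) * ρ := by
      rw [abs_of_pos ht]
      field_simp
      ring
    have h2 : 0 ≤ c * (B / R) * (ρ + R * |t|) ^ (-(α + 2)) * ρ := by positivity
    rw [h1]
    linarith

variable [NormedSpace ℝ E]

theorem DecayBound.norm_integral_le {ρ R α K L : ℝ} {f : ℝ → E} (hf : DecayBound ρ R α K L f)
    (hρ : 0 < ρ) (hR : 0 < R) (hα : 0 < α) :
    ‖∫ t, f t‖ ≤ 2 * K * ρ ^ (-(α + 1)) / (R * (α + 1)) + L * ρ ^ (-α) / (R * α) := by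
  obtain ⟨B, hB, hfB, hint⟩ := hf.exists_dominating hρ hR hα
  exact hint ▸ norm_integral_le_of_norm_le hB (.of_forall hfB)

theorem DecayBound.norm_integral_Iic_le {ρ R α K L : ℝ} {f : ℝ → E} (hf : DecayBound ρ R α K L f)
    (hρ : 0 < ρ) (hR : 0 < R) (hα : 0 < α) (s : ℝ) :
    ‖∫ t in Iic s, f t‖ ≤ 2 * K * ρ ^ (-(α + 1)) / (R * (α + 1)) + L * ρ ^ (-α) / (R * α) := by
  obtain ⟨B, hB, hfB, hint⟩ := hf.exists_dominating hρ hR hα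
  rw [← hint]
  exact (norm_integral_le_of_norm_le hB.integrableOn (.of_forall hfB)).trans
    (setIntegral_le_integral hB (.of_forall fun t => (norm_nonneg _).trans (hfB t)))

theorem DecayBound.norm_integral_Iic_le_of_nonpos {ρ R α K L : ℝ} {f : ℝ → E}
    (hf : DecayBound ρ R α K L f) (hρ : 0 < ρ) (hR : 0 < R) (hα : 0 < α) {s : ℝ} (hs : s ≤ 0) :
    ‖∫ t in Iic s, f t‖ ≤ K / (R * (α + 1)) * (ρ + R * |s|) ^ (-(α + 1)) := by
  have hi := (integrable_abs_rpow (p := α + 2) hρ hR (by linarith)).const_mul K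
  calc ‖∫ t in Iic s, f t‖ ≤ ∫ t in Iic s, K * (ρ + R * |t|) ^ (-(α + 2)) :=
        norm_integral_le_of_norm_le hi.integrableOn
          ((ae_restrict_iff' measurableSet_Iic).2 (.of_forall fun t ht => hf.1 t (le_trans ht hs)))
    _ = K / (R * (α + 1)) * (ρ + R * |s|) ^ (-(α + 1)) := by
        rw [integral_const_mul, integral_Iic_abs_rpow hρ hR (by linarith) hs,
          show α + 2 - 1 = α + 1 by ring]
        ring

theorem DecayBound.norm_double_integral_le {ρ R α K L : ℝ} {f : ℝ → E}
    (hf : DecayBound ρ R α K L f) (hρ : 0 < ρ) (hR : 0 < R) (hα : 0 < α) (hK : 0 ≤ K)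
    (hL : 0 ≤ L) (t : ℝ) :
    ‖∫ s in Iic t, ∫ τ in Iic s, f τ‖ ≤ 2 * K * ρ ^ (-α) / (R ^ 2 * α * (α + 1)) +
      (2 * K * ρ ^ (-(α + 1)) / (R * (α + 1)) + L * ρ ^ (-α) / (R * α)) * max t 0 := by
  set D := 2 * K * ρ ^ (-(α + 1)) / (R * (α + 1)) + L * ρ ^ (-α) / (R * α) with hD
  have hD0 : 0 ≤ D := by positivity
  have hi1 := (integrable_abs_rpow (p := α + 1) hρ hR (by linarith)).const_mul (K / (R * (α + 1)))
  have hi2 : Integrable ((Ioc 0 t).indicator fun _ => D) :=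
    (integrable_indicator_iff measurableSet_Ioc).2 (by simp)
  have hpos : ∀ s : ℝ, 0 ≤ K / (R * (α + 1)) * (ρ + R * |s|) ^ (-(α + 1)) := fun s => by
    positivity
  have hbound : ∀ s ∈ Iic t, ‖∫ τ in Iic s, f τ‖ ≤
      K / (R * (α + 1)) * (ρ + R * |s|) ^ (-(α + 1)) + (Ioc 0 t).indicator (fun _ => D) s := by
    intro s hst
    rcases le_or_gt s 0 with hs | hs
    · simpa [indicator, not_lt.2 hs] using hf.norm_integral_Iic_le_of_nonpos hρ hR hα hs
    · rw [indicator_of_mem (show s ∈ Ioc 0 t from ⟨hs, hst⟩)]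
      exact (hf.norm_integral_Iic_le hρ hR hα s).trans
        (le_add_of_nonneg_left (hpos s))
  calc _ ≤ ∫ s in Iic t, (K / (R * (α + 1)) * (ρ + R * |s|) ^ (-(α + 1)) +
          (Ioc 0 t).indicator (fun _ => D) s) :=
        norm_integral_le_of_norm_le (hi1.add hi2).integrableOn
          ((ae_restrict_iff' measurableSet_Iic).2 (.of_forall hbound))
    _ ≤ ∫ s, (K / (R * (α + 1)) * (ρ + R * |s|) ^ (-(α + 1)) +
          (Ioc 0 t).indicator (fun _ => D) s) :=
        setIntegral_le_integral (hi1.add hi2) (.of_forall fun s =>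
          add_nonneg (hpos s) (indicator_nonneg (fun _ _ => hD0) s))
    _ = _ := by
        rw [integral_add hi1 hi2, integral_const_mul, integral_indicator measurableSet_Ioc,
          integral_abs_rpow hρ hR (by linarith), show α + 1 - 1 = α by ring, setIntegral_const]
        simp only [measureReal_def, Real.volume_Ioc, sub_zero, ENNReal.toReal_ofReal',
          smul_eq_mul]
        congr 1
        · field_simp
        · ring

end Decay

/-- Mean value bound for the gradient along a segment that stays away from the origin. -/
theorem norm_gradient_sub_le {V : Euc n → ℝ} (hV : ContDiff ℝ 2 V) {β q m : ℝ} (hβ : 0 ≤ β)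
    (hq : 0 ≤ q) (hm : 0 < m)
    (hV2 : ∀ x, ‖iteratedFDeriv ℝ 2 V x‖ ≤ β * (1 + ‖x‖) ^ (-q)) {a b : Euc n}
    (hab : ∀ w ∈ segment ℝ a b, m ≤ 1 + ‖w‖) :
    ‖gradient V b - gradient V a‖ ≤ β * m ^ (-q) * ‖b - a‖ := by
  have hd : Differentiable ℝ (fderiv ℝ V) :=
    (hV.fderiv_right (m := 1) (by norm_num)).differentiable (by norm_num)
  have h := (convex_segment a b).norm_image_sub_le_of_norm_fderiv_le (𝕜 := ℝ) (f := fderiv ℝ V)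
    (C := β * m ^ (-q)) (fun w _ => hd w) (fun w hw => ?_) (left_mem_segment ℝ a b)
    (right_mem_segment ℝ a b)
  · simpa only [gradient, ← map_sub, LinearIsometryEquiv.norm_map] using h
  · have h1 : ‖fderiv ℝ (fderiv ℝ V) w‖ = ‖iteratedFDeriv ℝ 2 V w‖ := by
      rw [← norm_iteratedFDeriv_fderiv (n := 1), norm_iteratedFDeriv_one]
    rw [h1]
    exact (hV2 w).trans (mul_le_mul_of_nonneg_left
      (rpow_le_rpow_of_nonpos hm (hab w hw) (by linarith)) hβ)

theorem continuous_gradient {V : Euc n → ℝ} (hV : ContDiff ℝ 2 V) : Continuous (gradient V) :=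
  (InnerProductSpace.toDual ℝ (Euc n)).symm.continuous.comp (hV.continuous_fderiv (by norm_num))

theorem MemM.norm_le {r : ℝ} {f : ℝ → Euc n} (hf : MemM r f) :
    ∀ t, ‖f t‖ ≤ r + r * max t 0 := by
  obtain ⟨-, hb1, hb2, hr⟩ := hf
  unfold Mnorm at hr
  have h1 : ∀ t ≤ 0, ‖f t‖ ≤ sSup ((fun t => ‖f t‖) '' Iic 0) :=
    fun t ht => le_csSup hb1 ⟨t, ht, rfl⟩
  have h2 : ∀ t, 0 ≤ t → ‖f t‖ / (1 + t) ≤ sSup ((fun t => ‖f t‖ / (1 + t)) '' Ici 0) :=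
    fun t ht => le_csSup hb2 ⟨t, ht, rfl⟩
  have h10 := (norm_nonneg _).trans (h1 0 le_rfl)
  have h20 := (by positivity : (0:ℝ) ≤ ‖f 0‖ / (1 + 0)).trans (h2 0 le_rfl)
  intro t
  rcases le_total t 0 with ht | ht
  · rw [max_eq_right ht]
    exact (h1 t ht).trans (by linarith)
  · rw [max_eq_left ht, show r + r * t = r * (1 + t) by ring, ← div_le_iff₀ (by linarith)]
    exact (h2 t ht).trans (by linarith)

/-- A perturbation of uniform motion, displaced orthogonally to the velocity, moves away from the
origin at a linear rate. -/
theorem linear_escape {v x z u : Euc n} {t c r : ℝ} (hc : c ≤ ‖v‖ / 2) (hperp : ⟪v, x⟫ = 0)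
    (hz : ‖z - t • v‖ ≤ ‖v‖ / 2 * |t|) (hu : ‖u‖ ≤ r * (1 + |t|)) (θ : ℝ) :
    1 - r + (c - r) * |t| ≤ 1 + ‖z + θ • x + u‖ := by
  have h1 : |t| * ‖v‖ ≤ ‖t • v + θ • x‖ := by
    have := norm_add_sq_eq_norm_sq_add_norm_sq_real (x := t • v) (y := θ • x)
      (by rw [real_inner_smul_left, real_inner_smul_right, hperp, mul_zero, mul_zero])
    rw [← Real.norm_eq_abs, ← norm_smul]
    nlinarith [norm_nonneg (t • v), norm_nonneg (θ • x), norm_nonneg (t • v + θ • x)]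
  have h2 : ‖t • v + θ • x‖ ≤ ‖z + θ • x + u‖ + ‖z - t • v‖ + ‖u‖ := by
    calc ‖t • v + θ • x‖ = ‖(z + θ • x + u) - (z - t • v) - u‖ := by congr 1; abel
      _ ≤ _ := (norm_sub_le _ _).trans (add_le_add_left (norm_sub_le _ _) _)
  nlinarith [abs_nonneg t]

theorem escape_constant_le {n : ℕ} {α β β' v : ℝ} (hn : 2 ≤ n) (hα : 0 < α) (hβ : 0 < β)
    (hv0 : 0 < v) (hv : √(2 ^ 5 * (n : ℝ) * max β β' / α) ≤ v) :
    2 ^ ((5:ℝ)/2) * √n * β / (α * v) ≤ v / 2 := by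
  have hn1 : (1:ℝ) ≤ n := by exact_mod_cast (by omega : 1 ≤ n)
  have h1 := (Real.sqrt_le_left hv0.le).1 hv
  rw [div_le_iff₀ hα] at h1
  have h2 : (2:ℝ) ^ ((5:ℝ)/2) ≤ 8 :=
    calc (2:ℝ) ^ ((5:ℝ)/2) ≤ 2 ^ (3:ℝ) := rpow_le_rpow_of_exponent_le (by norm_num) (by norm_num)
      _ = 8 := by norm_num
  have h3 : √(n:ℝ) ≤ n := (Real.sqrt_le_left (by linarith)).2 (by nlinarith)
  rw [div_le_iff₀ (by positivity)]
  have h4 : 2 ^ ((5:ℝ)/2) * √n * β ≤ 8 * n * β := by gcongr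
  have h5 : (n:ℝ) * β ≤ n * max β β' := by gcongr; exact le_max_left _ _
  nlinarith

/-- The numerical comparison closing the estimate. -/
theorem final_bound_le {n : ℕ} {α β X r ρ R : ℝ} (hn : 2 ≤ n) (hα : 0 < α)
    (hX : 0 ≤ X) (hr : 0 < r) (hρ : 0 < ρ) (hρ1 : ρ ≤ 1) (hR : 0 < R) :
    2 * (2 * β / ρ * (2 * (β * (X + r + 1)) * ρ ^ (-α) / (R ^ 2 * α * (α + 1)))) * ρ ^ (-(α + 1)) /
          (R * (α + 1)) +
        2 * β / ρ * ((2 * (β * (X + r + 1)) * ρ ^ (-(α + 1)) / (R * (α + 1)) +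
          β * (r / R) * ρ ^ (-α) / (R * α)) / R) * ρ ^ (-α) / (R * α) ≤
      4 * β ^ 2 * (n : ℝ) ^ ((3:ℝ)/2) * (√n * (3 * X + 2 * r) + 2) /
          (α ^ 2 * R ^ 2 * ρ ^ (2 * α + 3)) * (1 / R + 1) ^ 2 := by
  have hn2 : (2:ℝ) ≤ n := by exact_mod_cast hn
  have hs1 : 1 ≤ √(n:ℝ) := Real.one_le_sqrt.2 (by linarith)
  have hn3 : (2:ℝ) ≤ (n:ℝ) ^ ((3:ℝ)/2) :=
    calc (2:ℝ) ≤ (n:ℝ) ^ (1:ℝ) := by simpa using hn2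
      _ ≤ _ := rpow_le_rpow_of_exponent_le (by linarith) (by norm_num)
  set P := ρ ^ α with hP
  have hP0 : 0 < P := rpow_pos_of_pos hρ α
  have e1 : ρ ^ (-α) = P⁻¹ := rpow_neg hρ.le α
  have e2 : ρ ^ (-(α + 1)) = (P * ρ)⁻¹ := by rw [rpow_neg hρ.le, rpow_add hρ, rpow_one]
  have e3 : ρ ^ (2 * α + 3) = P ^ 2 * ρ ^ 3 := by
    rw [rpow_add hρ, mul_comm 2 α, rpow_mul hρ.le]
    norm_cast
  rw [e1, e2, e3]
  set M := β ^ 2 / (α ^ 2 * R ^ 4 * P ^ 2 * ρ ^ 3) with hM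
  have hM0 : 0 ≤ M := by positivity
  have hk : 0 ≤ X + r + 1 := by linarith
  have hfac : 0 ≤ α / (α + 1) := by positivity
  have hfac1 : α / (α + 1) ≤ 1 := (div_le_one (by linarith)).2 (by linarith)
  have hL : 2 * (2 * β / ρ * (2 * (β * (X + r + 1)) * P⁻¹ / (R ^ 2 * α * (α + 1)))) * (P * ρ)⁻¹ /
          (R * (α + 1)) +
        2 * β / ρ * ((2 * (β * (X + r + 1)) * (P * ρ)⁻¹ / (R * (α + 1)) +
          β * (r / R) * P⁻¹ / (R * α)) / R) * P⁻¹ / (R * α) =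
      M * (8 * (X + r + 1) * R * ρ * (α / (α + 1) / (α + 1)) +
        4 * (X + r + 1) * R * ρ * (α / (α + 1)) + 2 * r * ρ ^ 2) := by
    rw [hM]
    field_simp
    ring
  have hRr : 4 * β ^ 2 * (n : ℝ) ^ ((3:ℝ)/2) * (√n * (3 * X + 2 * r) + 2) /
          (α ^ 2 * R ^ 2 * (P ^ 2 * ρ ^ 3)) * (1 / R + 1) ^ 2 =
      M * (4 * (n : ℝ) ^ ((3:ℝ)/2) * (√n * (3 * X + 2 * r) + 2) * (1 + R) ^ 2) := by
    rw [hM]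
    field_simp
  rw [hL, hRr]
  refine mul_le_mul_of_nonneg_left ?_ hM0
  have hfac2 : α / (α + 1) / (α + 1) ≤ 1 := (div_le_one (by linarith)).2 (by linarith)
  calc 8 * (X + r + 1) * R * ρ * (α / (α + 1) / (α + 1)) +
        4 * (X + r + 1) * R * ρ * (α / (α + 1)) + 2 * r * ρ ^ 2
      ≤ 8 * (X + r + 1) * R * 1 * 1 + 4 * (X + r + 1) * R * 1 * 1 + 2 * r * 1 ^ 2 := by gcongr
    _ ≤ 4 * 2 * (1 * (3 * X + 2 * r) + 2) * (1 + R) ^ 2 := by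
        nlinarith [mul_nonneg hX hR.le, mul_pos hr hR, mul_nonneg hk (sq_nonneg R),
          mul_nonneg hX (sq_nonneg R), mul_nonneg hr.le (sq_nonneg R), sq_nonneg R]
    _ ≤ _ := by gcongr

theorem statement_11
    (n : ℕ) (hn : 2 ≤ n) (α : ℝ) (hα0 : 0 < α) (hα1 : α ≤ 1)
    (Vl Vs : Euc n → ℝ) (βl0 βl1 βl2 βs1 βs2 βs3 : ℝ)
    (hβl0 : 0 < βl0) (hβl1 : 0 < βl1) (hβl2 : 0 < βl2)
    (hβs1 : 0 < βs1) (hβs2 : 0 < βs2) (hβs3 : 0 < βs3)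
    (hVl : LongRange α βl0 βl1 βl2 Vl) (hVs : ShortRange α βs1 βs2 βs3 Vs)
    (Fl Fs F : Euc n → Euc n)
    (hFl : ∀ y, Fl y = -gradient Vl y) (hFs : ∀ y, Fs y = -gradient Vs y)
    (hF : ∀ y, F y = Fl y + Fs y)
    (vm xm : Euc n) (hperp : ⟪vm, xm⟫ = 0) (hvm : Real.sqrt (2 ^ 5 * (n : ℝ) * max βl1 βl2 / α) ≤ ‖vm‖)
    (zm : ℝ → Euc n) (hzm : IsFreeSol Fl 0 vm atBot (2 ^ ((5:ℝ)/2) * Real.sqrt n * βl1 / (α * ‖vm‖)) zm)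
    (r : ℝ) (hr0 : 0 < r) (hr : r < min (‖vm‖ / 2 ^ ((3:ℝ)/2)) 1)
    (ym : ℝ → Euc n) (hym : MemM r ym) (hfix : Aop Fl F zm xm ym = ym)
 :
    ‖(∫ τ : ℝ, F (zm τ + xm + ym τ)) - ∫ τ : ℝ, F (zm τ + xm)‖ ≤
      4 * (max (max βl2 βs2) βs3) ^ 2 * (n : ℝ) ^ ((3:ℝ)/2) *
          (Real.sqrt n * (3 * ‖xm‖ + 2 * r) + 2) /
          (α ^ 2 * (‖vm‖ / 2 ^ ((3:ℝ)/2) - r) ^ 2 * (1 - r) ^ (2 * α + 3)) *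
        (1 / (‖vm‖ / 2 ^ ((3:ℝ)/2) - r) + 1) ^ 2 := by
  set c := ‖vm‖ / 2 ^ ((3:ℝ)/2) with hc
  set β := max (max βl2 βs2) βs3 with hβ
  obtain ⟨hVlC, -, hVl1, hVl2⟩ := hVl
  obtain ⟨hVsC, -, hVs1, hVs2⟩ := hVs
  obtain ⟨hzC, -, -, -, hzb⟩ := hzm
  have hrc : r < c := hr.trans_le (min_le_left _ _)
  have hρ : 0 < 1 - r := sub_pos.2 (hr.trans_le (min_le_right _ _))
  have hR : 0 < c - r := sub_pos.2 hrc
  have hv0 : 0 < ‖vm‖ := (norm_nonneg _).lt_of_ne fun h => by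
    rw [hc, ← h, zero_div] at hrc
    exact absurd hr0 hrc.not_gt
  have hpow2 : (2:ℝ) ≤ 2 ^ ((3:ℝ)/2) := self_le_rpow_of_one_le one_le_two (by norm_num)
  have hc2 : c ≤ ‖vm‖ / 2 := div_le_div_of_nonneg_left hv0.le two_pos hpow2
  have hz : ∀ t, ‖zm t - t • vm‖ ≤ ‖vm‖ / 2 * |t| := fun t => by
    have h := hzb t
    rw [sub_zero] at h
    exact h.trans (mul_le_mul_of_nonneg_right (escape_constant_le hn hα0 hβl1 hv0 hvm)
      (abs_nonneg t))
  have hβ0 : 0 < β := hβs3.trans_le (le_max_right _ _)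
  have hβl2' : βl2 ≤ β := (le_max_left _ _).trans (le_max_left _ _)
  have hβs2' : βs2 ≤ β := (le_max_right _ _).trans (le_max_left _ _)
  have hβs3' : βs3 ≤ β := le_max_right _ _
  have hy := hym.norm_le
  have hu : ∀ t, ∀ θ ∈ Icc (0:ℝ) 1, ‖θ • ym t‖ ≤ r * (1 + |t|) := fun t θ hθ => by
    have h1 : max t 0 ≤ |t| := max_le (le_abs_self t) (abs_nonneg t)
    rw [norm_smul, Real.norm_of_nonneg hθ.1]
    nlinarith [hy t, hθ.2, norm_nonneg (ym t)]
  have hm0 : ∀ t : ℝ, 0 < 1 - r + (c - r) * |t| := fun t => by positivity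
  have hesc : ∀ t η, ∀ θ ∈ Icc (0:ℝ) 1,
      1 - r + (c - r) * |t| ≤ 1 + ‖zm t + η • xm + θ • ym t‖ := fun t η θ hθ =>
    linear_escape hc2 hperp (hz t) (hu t θ hθ) η
  have hesc0 : ∀ t, 1 - r + (c - r) * |t| ≤ 1 + ‖zm t + xm‖ := fun t => by
    simpa using hesc t 1 0 (by simp)
  have hesc1 : ∀ t, 1 - r + (c - r) * |t| ≤ 1 + ‖zm t + xm + ym t‖ := fun t => by
    simpa using hesc t 1 1 (by simp)
  have hFlbd : ∀ t w, 1 - r + (c - r) * |t| ≤ 1 + ‖w‖ →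
      ‖Fl w‖ ≤ βl1 * (1 - r + (c - r) * |t|) ^ (-(α + 1)) := fun t w hw => by
    rw [hFl, norm_neg]
    exact (hVl1 w).trans (mul_le_mul_of_nonneg_left
      (rpow_le_rpow_of_nonpos (hm0 t) hw (by linarith)) hβl1.le)
  have hFsbd : ∀ t w, 1 - r + (c - r) * |t| ≤ 1 + ‖w‖ →
      ‖Fs w‖ ≤ βs2 * (1 - r + (c - r) * |t|) ^ (-(α + 2)) := fun t w hw => by
    rw [hFs, norm_neg]
    exact (hVs1 w).trans (mul_le_mul_of_nonneg_left
      (rpow_le_rpow_of_nonpos (hm0 t) hw (by linarith)) hβs2.le)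
  have hFcont : Continuous F := by
    have : F = fun y => -gradient Vl y + -gradient Vs y := funext fun y => by rw [hF, hFl, hFs]
    rw [this]
    exact (continuous_gradient hVlC).neg.add (continuous_gradient hVsC).neg
  have hFint : ∀ w : ℝ → Euc n, Continuous w →
      (∀ t, 1 - r + (c - r) * |t| ≤ 1 + ‖w t‖) → Integrable fun t => F (w t) := fun w hw hwm => by
    refine (((integrable_abs_rpow hρ hR (by linarith : 1 < α + 1)).const_mul βl1).add
      ((integrable_abs_rpow hρ hR (by linarith : 1 < α + 2)).const_mul βs2)).mono'
      (hFcont.comp hw).aestronglyMeasurable (.of_forall fun t => ?_)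
    simp only [hF]
    exact norm_add_le_of_le (hFlbd t _ (hwm t)) (hFsbd t _ (hwm t))
  have hdecay : DecayBound (1 - r) (c - r) α (β * (‖xm‖ + r + 1)) (β * (r / (c - r)))
      (fun τ => F (zm τ + xm + ym τ) - Fl (zm τ)) := by
    refine .of_growth hρ hR hβ0.le hr0.le fun t => ?_
    have hgrad : ‖gradient Vl (zm t + xm + ym t) - gradient Vl (zm t)‖ ≤
        βl2 * (1 - r + (c - r) * |t|) ^ (-(α + 2)) * ‖zm t + xm + ym t - zm t‖ := by
      refine norm_gradient_sub_le hVlC hβl2.le (by linarith) (hm0 t) hVl2 fun w hw => ?_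
      rw [segment_eq_image'] at hw
      obtain ⟨θ, hθ, rfl⟩ := hw
      convert hesc t θ θ hθ using 3
      module
    have hFl' : ‖Fl (zm t + xm + ym t) - Fl (zm t)‖ ≤
        β * (1 - r + (c - r) * |t|) ^ (-(α + 2)) * (‖xm‖ + ‖ym t‖) := by
      rw [hFl, hFl, neg_sub_neg, norm_sub_rev]
      refine hgrad.trans ?_
      rw [add_assoc, add_sub_cancel_left]
      have := (rpow_pos_of_pos (hm0 t) (-(α + 2))).le
      gcongr
      exact norm_add_le _ _
    have hFs' : ‖Fs (zm t + xm + ym t)‖ ≤ β * (1 - r + (c - r) * |t|) ^ (-(α + 2)) :=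
      (hFsbd t _ (hesc1 t)).trans (mul_le_mul_of_nonneg_right hβs2'
        (rpow_pos_of_pos (hm0 t) _).le)
    calc ‖F (zm t + xm + ym t) - Fl (zm t)‖
        = ‖(Fl (zm t + xm + ym t) - Fl (zm t)) + Fs (zm t + xm + ym t)‖ := by
          rw [hF, add_sub_right_comm]
      _ ≤ _ := norm_add_le_of_le hFl' hFs'
      _ = β * (1 - r + (c - r) * |t|) ^ (-(α + 2)) * (‖xm‖ + ‖ym t‖ + 1) := by ring
      _ ≤ _ := mul_le_mul_of_nonneg_left (by linarith [hy t])
          (mul_nonneg hβ0.le (rpow_pos_of_pos (hm0 t) _).le)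
  have hK : 0 ≤ β * (‖xm‖ + r + 1) := by positivity
  have hL : 0 ≤ β * (r / (c - r)) := by positivity
  let Y := 2 * (β * (‖xm‖ + r + 1)) * (1 - r) ^ (-α) / ((c - r) ^ 2 * α * (α + 1))
  let D := 2 * (β * (‖xm‖ + r + 1)) * (1 - r) ^ (-(α + 1)) / ((c - r) * (α + 1)) +
    β * (r / (c - r)) * (1 - r) ^ (-α) / ((c - r) * α)
  have hD : 0 ≤ D := by positivity
  have hygrow : ∀ t, ‖ym t‖ ≤ Y + D * max t 0 := fun t =>
    (congrArg norm (congrFun hfix t)).symm.trans_le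
      (hdecay.norm_double_integral_le hρ hR hα0 hK hL t)
  have hdiff : DecayBound (1 - r) (c - r) α (2 * β / (1 - r) * Y) (2 * β / (1 - r) * (D / (c - r)))
      (fun τ => F (zm τ + xm + ym τ) - F (zm τ + xm)) := by
    refine .of_growth hρ hR (by positivity) hD fun t => le_trans ?_ (mul_le_mul_of_nonneg_left (hygrow t)
        (mul_nonneg (by positivity) (rpow_pos_of_pos (hm0 t) _).le))
    have hseg : ∀ w ∈ segment ℝ (zm t + xm) (zm t + xm + ym t),
        1 - r + (c - r) * |t| ≤ 1 + ‖w‖ := fun w hw => by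
      rw [segment_eq_image'] at hw
      obtain ⟨θ, hθ, rfl⟩ := hw
      simpa using hesc t 1 θ hθ
    have hl := norm_gradient_sub_le hVlC hβl2.le (by linarith) (hm0 t) hVl2 hseg
    have hs := norm_gradient_sub_le hVsC hβs3.le (by linarith) (hm0 t) hVs2 hseg
    rw [add_sub_cancel_left] at hl hs
    have hP := rpow_pos_of_pos (hm0 t) (-(α + 2))
    have hpow : (1 - r + (c - r) * |t|) ^ (-(α + 3)) ≤
        (1 - r + (c - r) * |t|) ^ (-(α + 2)) / (1 - r) := by
      rw [show -(α + 3) = -(α + 2) - 1 by ring, rpow_sub_one (hm0 t).ne']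
      refine div_le_div_of_nonneg_left hP.le hρ ?_
      have : 0 ≤ (c - r) * |t| := by positivity
      linarith
    have hpow' : (1 - r + (c - r) * |t|) ^ (-(α + 2)) ≤
        (1 - r + (c - r) * |t|) ^ (-(α + 2)) / (1 - r) := by
      rw [le_div_iff₀ hρ]
      nlinarith
    calc ‖F (zm t + xm + ym t) - F (zm t + xm)‖
        = ‖(gradient Vl (zm t + xm + ym t) - gradient Vl (zm t + xm)) +
            (gradient Vs (zm t + xm + ym t) - gradient Vs (zm t + xm))‖ := by
          rw [hF, hF, hFl, hFl, hFs, hFs, ← norm_neg]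
          congr 1
          abel
      _ ≤ _ := norm_add_le_of_le hl hs
      _ ≤ β * ((1 - r + (c - r) * |t|) ^ (-(α + 2)) / (1 - r)) * ‖ym t‖ +
          β * ((1 - r + (c - r) * |t|) ^ (-(α + 2)) / (1 - r)) * ‖ym t‖ := by gcongr
      _ = _ := by ring
  rw [← integral_sub (hFint (fun t => zm t + xm + ym t) ((hzC.continuous.add_const xm).add hym.1) hesc1)
    (hFint (fun t => zm t + xm) (hzC.continuous.add_const xm) hesc0)]
  exact (hdiff.norm_integral_le hρ hR hα0).trans
    (final_bound_le hn hα0 (norm_nonneg xm) hr0 hρ (by linarith) hR)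

end Paper
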